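/- Let ν, s ∈ ℝ with ν ≠ 0, and let x be a solution of the class-D equation with parameters (ν, 0, s), i.e. x′(t) = ν·sin(x(t)) + s·sin(t) for all t. Then the sequence (x(2πn) − x(0))/(2πn) tends to 0 as n → ∞ (the rotation number of the equation with a = 0 is zero). -/

import Mathlib

open Real Filter

/-- `x` is a global solution of `ẋ = ν sin x + s sin t`. -/
def IsClassDSolution (ν s : ℝ) (x : ℝ → ℝ) : Prop :=
  ∀ t : ℝ, HasDerivAt x (ν * Real.sin (x t) + s * Real.sin t) t

namespace IsClassDSolution

variable {ν s : ℝ} {x y : ℝ → ℝ}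

theorem eq_of_eq_at (hx : IsClassDSolution ν s x) (hy : IsClassDSolution ν s y) {t₀ : ℝ}
    (h : x t₀ = y t₀) : x = y := by
  have hv : ∀ t : ℝ, LipschitzOnWith ‖ν‖₊ (fun u : ℝ => ν * Real.sin u + s * Real.sin t)
      Set.univ := fun t => by
    refine (LipschitzWith.of_dist_le_mul fun u v => ?_).lipschitzOnWith
    rw [dist_add_right, Real.dist_eq, Real.dist_eq, ← mul_sub, abs_mul, coe_nnnorm,
      Real.norm_eq_abs]
    refine mul_le_mul_of_nonneg_left ?_ (abs_nonneg ν)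
    simpa [Real.dist_eq] using Real.lipschitzWith_sin.dist_le_mul u v
  exact ODE_solution_unique_univ hv (fun t => ⟨hx t, trivial⟩) (fun t => ⟨hy t, trivial⟩) h

theorem le_of_le_at (hx : IsClassDSolution ν s x) (hy : IsClassDSolution ν s y) {t₀ : ℝ}
    (h : x t₀ ≤ y t₀) (t : ℝ) : x t ≤ y t := by
  by_contra! hlt
  have hcont : Continuous fun u => x u - y u :=
    continuous_iff_continuousAt.2 fun u => ((hx u).sub (hy u)).continuousAt
  obtain ⟨c, hc⟩ : (0 : ℝ) ∈ Set.range fun u => x u - y u :=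
    mem_range_of_exists_le_of_exists_ge hcont ⟨t₀, by linarith⟩ ⟨t, by linarith⟩
  have hxy := hx.eq_of_eq_at hy (sub_eq_zero.1 hc)
  rw [hxy] at hlt
  exact lt_irrefl _ hlt

theorem add_int_mul_two_pi (hx : IsClassDSolution ν s x) (k : ℤ) :
    IsClassDSolution ν s fun t => x t + k * (2 * π) := fun t => by
  simpa [Real.sin_add_int_mul_two_pi] using (hx t).add_const (k * (2 * π))

theorem comp_add_nat_mul_two_pi (hx : IsClassDSolution ν s x) (n : ℕ) :
    IsClassDSolution ν s fun t => x (t + n * (2 * π)) := fun t => by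
  simpa [Real.sin_add_nat_mul_two_pi] using (hx (t + n * (2 * π))).comp_add_const t (n * (2 * π))

/-- Time reversal combined with a half-turn preserves the equation. -/
theorem comp_neg_add_pi (hx : IsClassDSolution ν s x) :
    IsClassDSolution ν s fun t => x (-t) + π := fun t => by
  have h := ((hx (-t)).comp t (hasDerivAt_neg t)).add_const π
  refine h.congr_deriv ?_
  simp only [Real.sin_add_pi, Real.sin_neg]
  ring

/-- The difference of two solutions varies by at most one full turn. -/
theorem abs_sub_sub_sub_le (hx : IsClassDSolution ν s x) (hy : IsClassDSolution ν s y)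
    (t₀ t : ℝ) : |(x t - y t) - (x t₀ - y t₀)| ≤ 2 * π := by
  have hπ := Real.two_pi_pos
  set k : ℤ := ⌊(x t₀ - y t₀) / (2 * π)⌋
  have hlow : k * (2 * π) ≤ x t₀ - y t₀ := (le_div_iff₀ hπ).1 (Int.floor_le _)
  have hupp : x t₀ - y t₀ ≤ (k + 1) * (2 * π) :=
    (div_le_iff₀ hπ).1 (Int.lt_floor_add_one _).le
  have hlow_t := (hy.add_int_mul_two_pi k).le_of_le_at hx (t₀ := t₀) (by linarith) t
  have hupp_t := hx.le_of_le_at (hy.add_int_mul_two_pi (k + 1)) (t₀ := t₀)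
    (by push_cast; linarith) t
  push_cast at hupp_t
  rw [abs_le]
  constructor <;> linarith

theorem abs_sub_le_two_pi (hx : IsClassDSolution ν s x) (n : ℕ) :
    |x (2 * π * n) - x 0| ≤ 2 * π := by
  have hrev := hx.abs_sub_sub_sub_le hx.comp_neg_add_pi 0 (2 * π * n)
  have hshift := (hx.comp_add_nat_mul_two_pi n).abs_sub_sub_sub_le hx 0 (-(2 * π * n))
  simp only [neg_zero, zero_add, mul_comm (n : ℝ) (2 * π), neg_add_cancel] at hrev hshift
  rw [abs_le] at *
  constructor <;> linarith

end IsClassDSolution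

/-- If `ν ≠ 0` and `x` solves `ẋ = ν sin x + s sin t` (the class-D equation with `a = 0`),
then `(x(2πn) - x(0))/(2πn) → 0`: the rotation number at `a = 0` is zero. -/
theorem classD_rotation_number_zero_at_a_eq_zero
    (ν s : ℝ) (hν : ν ≠ 0) (x : ℝ → ℝ)
    (hx : ∀ t : ℝ, HasDerivAt x (ν * Real.sin (x t) + s * Real.sin t) t) :
    Tendsto (fun n : ℕ => (x (2 * π * n) - x 0) / (2 * π * n)) atTop (nhds 0) := by
  have hsol : IsClassDSolution ν s x := hx
  exact tendsto_bdd_div_atTop_nhds_zero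
    (Eventually.of_forall fun n => (abs_le.1 (hsol.abs_sub_le_two_pi n)).1)
    (Eventually.of_forall fun n => (abs_le.1 (hsol.abs_sub_le_two_pi n)).2)
    (tendsto_natCast_atTop_atTop.const_mul_atTop Real.two_pi_pos)
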